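/- arXiv:1101.0129 — 4 statements merged into one kernel-verified Lean document; each statement's English description precedes it below -/
import Mathlib

section
/- Let Ξ be an n×n skew-symmetric matrix over a commutative ring, and suppose {1,…,n} = I₁ ⊔ I₂ where I₂ = {a+1, a+2, …, a+m} is an interval of even length m, and suppose ξ_{ij} = 0 whenever i ∈ I₁ and j ∈ I₂. Then for every subset K ⊆ {1,…,n}, Pf(Ξ_K) = Pf(Ξ_{K ∩ I₁}) · Pf(Ξ_{K ∩ I₂}). (This is the matrix identity underlying the fact that the tensor product of two edge-labelled Pfaffian gates, whose labels interleave as one even consecutive block inside the labels of the other, equals the subPfaffian tensor of the direct sum of their matrices.) -/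
/-- The subPfaffian of a skew-symmetric matrix, defined by recursive expansion
along the row of the minimal index of `I`; `pf M I` is the Pfaffian of the principal
submatrix of `M` on the index set `I`.  It is `1` for `I = ∅` and `0` for `|I|` odd. -/
def pf {R : Type*} [CommRing R] (M : ℕ → ℕ → R) (I : Finset ℕ) : R :=
  if h : I.Nonempty then
    ∑ j ∈ I.erase (I.min' h),
      (-1 : R) ^ ((I.filter (fun t => t < j)).card + 1) * M (I.min' h) j *
        pf M ((I.erase (I.min' h)).erase j)
  else 1
termination_by I.card
decreasing_by
  exact lt_of_le_of_lt (Finset.card_le_card (Finset.erase_subset _ _))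
    (Finset.card_erase_lt_of_mem (I.min'_mem h))

theorem pf_expand {R : Type*} [CommRing R] (M : ℕ → ℕ → R) (I : Finset ℕ) (x : ℕ)
    (hx : x ∈ I) (hmin : ∀ y ∈ I, x ≤ y) :
    pf M I = ∑ j ∈ I.erase x,
      (-1 : R) ^ ((I.filter (fun t => t < j)).card + 1) * M x j *
        pf M ((I.erase x).erase j) := by
  have hne : I.Nonempty := ⟨x, hx⟩
  have e : I.min' hne = x := le_antisymm (I.min'_le x hx) (hmin _ (I.min'_mem hne))
  rw [pf, dif_pos hne, e]

theorem pf_empty' {R : Type*} [CommRing R] (M : ℕ → ℕ → R) : pf M ∅ = 1 := by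
  rw [pf]; simp

theorem pf_odd {R : Type*} [CommRing R] (M : ℕ → ℕ → R) (k : ℕ) : ∀ (I : Finset ℕ),
    I.card = k → Odd k → pf M I = 0 := by
  induction k using Nat.strong_induction_on with
  | _ k ih =>
    intro I hI hk
    have hne : I.Nonempty := by
      rw [← Finset.card_pos, hI]; exact hk.pos
    rw [pf_expand M I _ (I.min'_mem hne) (fun y hy => I.min'_le y hy)]
    apply Finset.sum_eq_zero
    intro j hj
    have c1 := Finset.card_erase_add_one hj
    have c2 := Finset.card_erase_add_one (I.min'_mem hne)
    rw [ih (((I.erase (I.min' hne)).erase j).card) (by omega) _ rfl, mul_zero]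
    rw [Nat.odd_iff] at hk ⊢
    omega

theorem pf_block {R : Type*} [CommRing R] (M : ℕ → ℕ → R) (k : ℕ) : ∀ (A B : Finset ℕ),
    (A ∪ B).card = k → Disjoint A B →
    (∀ x ∈ A, (∀ b ∈ B, x < b) ∨ (∀ b ∈ B, b < x)) →
    (∀ x ∈ A, ∀ b ∈ B, M x b = 0) → (∀ x ∈ A, ∀ b ∈ B, M b x = 0) →
    pf M (A ∪ B) = pf M A * pf M B := by
  induction k using Nat.strong_induction_on with
  | _ k ih =>
    intro A B hk hd hint h0 h0'
    have hd' := Finset.disjoint_left.mp hd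
    rcases (A ∪ B).eq_empty_or_nonempty with he | hne
    · have := Finset.union_eq_empty.mp he
      rw [he, this.1, this.2, pf_empty', mul_one]
    obtain ⟨x, hx, hmin⟩ : ∃ x ∈ A ∪ B, ∀ y ∈ A ∪ B, x ≤ y :=
      ⟨_, (A ∪ B).min'_mem hne, fun y hy => (A ∪ B).min'_le y hy⟩
    have hcard : ∀ C : Finset ℕ, C ⊆ A ∪ B → x ∉ C → C.card < k := by
      intro C hC hxC
      rw [← hk]
      exact Finset.card_lt_card ⟨hC, fun h => hxC (h hx)⟩
    rw [pf_expand M (A ∪ B) x hx hmin]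
    rcases Finset.mem_union.mp hx with hxA | hxB
    · have hxB : x ∉ B := hd' hxA
      rw [pf_expand M A x hxA (fun y hy => hmin y (Finset.mem_union_left _ hy)), Finset.sum_mul]
      symm
      have hsub : A.erase x ⊆ (A ∪ B).erase x :=
        Finset.erase_subset_erase _ Finset.subset_union_left
      rw [← Finset.sum_subset hsub]
      · apply Finset.sum_congr rfl
        intro j hj
        have hjA : j ∈ A := Finset.mem_of_mem_erase hj
        have hjB : j ∉ B := hd' hjA
        have e : ((A ∪ B).erase x).erase j = ((A.erase x).erase j) ∪ B := by
          ext t; simp only [Finset.mem_erase, Finset.mem_union]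
          grind
        have hs : (A.erase x).erase j ⊆ A :=
          (Finset.erase_subset _ _).trans (Finset.erase_subset _ _)
        rw [e, ih _ (hcard (((A.erase x).erase j) ∪ B)
            (Finset.union_subset_union_left hs) (by simp [hxB])) _ _ rfl
          (Finset.disjoint_of_subset_left hs hd) (fun y hy => hint y (hs hy))
          (fun y hy => h0 y (hs hy)) (fun y hy => h0' y (hs hy))]
        rcases Nat.even_or_odd B.card with hB | hB
        · have hc : ((A ∪ B).filter (fun t => t < j)).card =
              (A.filter (fun t => t < j)).card + (B.filter (fun t => t < j)).card := by
            rw [Finset.filter_union, Finset.card_union_of_disjoint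
              (Finset.disjoint_filter_filter hd)]
          have hev : Even (B.filter (fun t => t < j)).card := by
            rcases hint j hjA with h | h
            · rw [Finset.filter_false_of_mem (fun b hb => not_lt.mpr (h b hb).le)]
              simp
            · rwa [Finset.filter_true_of_mem h]
          rw [hc, add_right_comm, pow_add _ _ (B.filter (fun t => t < j)).card, hev.neg_one_pow]
          ring
        · rw [pf_odd M _ B rfl hB]; simp
      · intro j hj hj'
        have hjB : j ∈ B := by
          simp only [Finset.mem_erase, Finset.mem_union] at hj hj'
          tauto
        rw [h0 x hxA j hjB]; simp
    · have hxA : x ∉ A := fun h => hd' h hxB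
      rw [pf_expand M B x hxB (fun y hy => hmin y (Finset.mem_union_right _ hy)), Finset.mul_sum]
      symm
      have hsub : B.erase x ⊆ (A ∪ B).erase x :=
        Finset.erase_subset_erase _ Finset.subset_union_right
      rw [← Finset.sum_subset hsub]
      · apply Finset.sum_congr rfl
        intro j hj
        have hjB : j ∈ B := Finset.mem_of_mem_erase hj
        have hjA : j ∉ A := fun h => hd' h hjB
        have e : ((A ∪ B).erase x).erase j = A ∪ ((B.erase x).erase j) := by
          ext t; simp only [Finset.mem_erase, Finset.mem_union]
          grind
        have hs : (B.erase x).erase j ⊆ B :=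
          (Finset.erase_subset _ _).trans (Finset.erase_subset _ _)
        rw [e, ih _ (hcard (A ∪ ((B.erase x).erase j))
            (Finset.union_subset_union_right hs) (by simp [hxA])) _ _ rfl
          (Finset.disjoint_of_subset_right hs hd)
          (fun y hy => (hint y hy).imp (fun h b hb => h b (hs hb)) (fun h b hb => h b (hs hb)))
          (fun y hy b hb => h0 y hy b (hs hb)) (fun y hy b hb => h0' y hy b (hs hb))]
        have hf : A.filter (fun t => t < j) = ∅ := by
          apply Finset.filter_false_of_mem
          intro y hy
          rcases hint y hy with h | h
          · exact absurd (h x hxB) (not_lt.mpr (hmin y (Finset.mem_union_left _ hy)))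
          · exact not_lt.mpr (h j hjB).le
        rw [Finset.filter_union, hf, Finset.empty_union]
        ring
      · intro j hj hj'
        have hjA : j ∈ A := by
          simp only [Finset.mem_erase, Finset.mem_union] at hj hj'
          tauto
        rw [h0' j hjA x hxB]; simp

/-- If `{1,…,n} = I₁ ⊔ I₂` where `I₂ = {a+1,…,a+m}` is an interval of even length `m`
and the entries of the skew-symmetric matrix `Ξ` connecting `I₁` to `I₂` vanish, then
for every `K ⊆ {1,…,n}`, `Pf(Ξ_K) = Pf(Ξ_{K ∩ I₁}) * Pf(Ξ_{K ∩ I₂})`. -/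
theorem subPfaffian_interleaved_block {R : Type*} [CommRing R] (n a m : ℕ)
    (Ξ : ℕ → ℕ → R) (hskew : ∀ i j, Ξ j i = - Ξ i j)
    (hm : Even m) (ham : a + m ≤ n)
    (I₂ : Finset ℕ) (hI₂ : I₂ = Finset.Icc (a + 1) (a + m))
    (I₁ : Finset ℕ) (hI₁ : I₁ = Finset.Icc 1 n \ I₂)
    (hzero : ∀ i ∈ I₁, ∀ j ∈ I₂, Ξ i j = 0)
    (K : Finset ℕ) (hK : K ⊆ Finset.Icc 1 n) :
    pf Ξ K = pf Ξ (K ∩ I₁) * pf Ξ (K ∩ I₂) := by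
  have hu : K = (K ∩ I₁) ∪ (K ∩ I₂) := by
    ext t
    have := @hK t
    subst hI₁
    simp only [Finset.mem_union, Finset.mem_inter, Finset.mem_sdiff]
    tauto
  conv_lhs => rw [hu]
  have hz : ∀ x ∈ K ∩ I₁, ∀ b ∈ K ∩ I₂, Ξ x b = 0 := fun x hx b hb =>
    hzero x (Finset.mem_inter.mp hx).2 b (Finset.mem_inter.mp hb).2
  refine pf_block Ξ _ _ _ rfl ?_ ?_ hz ?_
  · rw [Finset.disjoint_left]
    subst hI₁
    simp only [Finset.mem_inter, Finset.mem_sdiff]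
    tauto
  · intro x hx
    subst hI₁ hI₂
    simp only [Finset.mem_inter, Finset.mem_sdiff, Finset.mem_Icc] at hx ⊢
    by_cases h : x ≤ a
    · left; intro b hb; omega
    · right; intro b hb; omega
  · intro x hx b hb
    rw [hskew x b, hz x hx b hb, neg_zero]
end

section
/- (Valiant's Pfaffian Sum Theorem, as the kernel theorem with θ_{ij} = λ_i λ_j.) Let Ξ be an n×n skew-symmetric matrix over a commutative ring with n even, and let λ₁,…,λ_n be ring elements. Let Λ̃ be the skew-symmetric matrix with entries λ̃_{ij} = (−1)^{i+j+1} λ_i λ_j for i < j. Then ∑_{J ⊆ {1,…,n}, |Jᶜ| even} (∏_{i ∈ Jᶜ} λ_i) · Pf(Ξ_J) = Pf(Λ̃ + Ξ), where Jᶜ = {1,…,n} ∖ J. -/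
open Finset in
theorem pf_insert_min {R : Type*} [CommRing R] (M : ℕ → ℕ → R) (S : Finset ℕ) (a : ℕ)
    (ha : ∀ x ∈ S, a < x) :
    pf M (insert a S) = ∑ j ∈ S, (-1 : R) ^ (S.filter (fun t => t < j)).card * M a j *
      pf M (S.erase j) := by
  have hne : (insert a S).Nonempty := insert_nonempty a S
  have haS : a ∉ S := fun h => lt_irrefl _ (ha a h)
  have hmin : (insert a S).min' hne = a := by
    apply le_antisymm
    · exact min'_le _ _ (mem_insert_self _ _)
    · apply le_min'
      intro y hy
      rcases mem_insert.1 hy with h | h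
      · exact h.ge
      · exact (ha y h).le
  rw [pf, dif_pos hne]
  simp only [hmin]
  rw [erase_insert haS]
  refine sum_congr rfl fun j hj => ?_
  rw [filter_insert, if_pos (ha j hj), card_insert_of_notMem (by simp [haS]), pow_add, pow_add]
  simp

open Finset in
theorem alt_sum {R : Type*} [CommRing R] (S : Finset ℕ) :
    ∑ j ∈ S, (-1 : R) ^ (S.filter (fun t => t < j)).card = if Even S.card then 0 else 1 := by
  induction S using Finset.induction_on_max with
  | empty => simp
  | insert a s h ih =>
    have has : a ∉ s := fun h' => lt_irrefl _ (h a h')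
    rw [sum_insert has, card_insert_of_notMem has]
    have h1 : ∑ j ∈ s, (-1 : R) ^ ((insert a s).filter (fun t => t < j)).card
        = ∑ j ∈ s, (-1 : R) ^ (s.filter (fun t => t < j)).card := by
      refine sum_congr rfl fun j hj => ?_
      rw [filter_insert, if_neg (not_lt.2 (h j hj).le)]
    rw [h1, ih, filter_insert, if_neg (lt_irrefl _), filter_true_of_mem h]
    by_cases he : Even s.card
    · simp [he, Nat.even_add_one]
    · simp [he, Nat.even_add_one, (Nat.not_even_iff_odd.1 he).neg_one_pow]

/-- Signed product weight. -/
def wt {R : Type*} [CommRing R] (μ : ℕ → R) (I K : Finset ℕ) : R :=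
  ∏ k ∈ K, ((-1 : R) ^ (I.filter (fun t => t < k)).card * μ k)

open Finset in
theorem wt_insert_min {R : Type*} [CommRing R] (μ : ℕ → R) (S K : Finset ℕ) (a : ℕ)
    (ha : ∀ x ∈ S, a < x) (hK : K ⊆ S) :
    wt μ (insert a S) K = (-1) ^ K.card * wt μ S K := by
  have haS : a ∉ S := fun h => lt_irrefl _ (ha a h)
  unfold wt
  rw [← prod_const, ← prod_mul_distrib]
  refine prod_congr rfl fun k hk => ?_
  rw [filter_insert, if_pos (ha k (hK hk)), card_insert_of_notMem (by simp [haS]), pow_succ]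
  ring

open Finset in
theorem wt_erase {R : Type*} [CommRing R] (μ : ℕ → R) (S K : Finset ℕ) (j : ℕ)
    (hj : j ∈ S) (hK : K ⊆ S.erase j) :
    wt μ S K = (-1) ^ (K.filter (fun t => j < t)).card * wt μ (S.erase j) K := by
  unfold wt
  rw [← prod_const, prod_filter, ← prod_mul_distrib]
  refine prod_congr rfl fun k hk => ?_
  rw [filter_erase]
  split_ifs with h
  · have hm : j ∈ S.filter (fun t => t < k) := by simp [hj, h]
    rw [← card_erase_add_one hm, pow_succ]
    ring
  · rw [erase_eq_of_notMem (by simp [h])]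
    ring

open Finset in
theorem card_split (K : Finset ℕ) (j : ℕ) (hj : j ∉ K) :
    (K.filter (fun t => t < j)).card + (K.filter (fun t => j < t)).card = K.card := by
  rw [← card_filter_add_card_filter_not (s := K) (fun t => t < j)]
  congr 2
  refine filter_congr fun x hx => ?_
  have : x ≠ j := fun h => hj (h ▸ hx)
  omega

theorem neg_one_pow_parity {R : Type*} [CommRing R] {a b : ℕ} (h : Even (a + b)) :
    (-1 : R) ^ a = (-1) ^ b := by
  rcases Nat.even_or_odd a with ha | ha
  · have hb : Even b := by rw [Nat.even_add] at h; tauto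
    rw [ha.neg_one_pow, hb.neg_one_pow]
  · have hb : Odd b := by
      rw [← Nat.not_even_iff_odd] at *
      rw [Nat.even_add] at h; tauto
    rw [ha.neg_one_pow, hb.neg_one_pow]

open Finset in
theorem pf_key {R : Type*} [CommRing R] (Ξ Λ : ℕ → ℕ → R) (μ : ℕ → R)
    (hΛ : ∀ i j, i < j → Λ i j = - (μ i * μ j)) (I : Finset ℕ) :
    pf (fun i j => Λ i j + Ξ i j) I
      = ∑ K ∈ I.powerset, if Even K.card then wt μ I K * pf Ξ (I \ K) else 0 := by
  induction hc : I.card using Nat.strong_induction_on generalizing I with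
  | _ n ih =>
  rcases I.eq_empty_or_nonempty with rfl | hne
  · simp [wt, pf]
  obtain ⟨a, S, ha, rfl⟩ : ∃ a S, (∀ x ∈ S, a < x) ∧ I = insert a S := by
    refine ⟨I.min' hne, I.erase (I.min' hne), fun x hx => ?_, ?_⟩
    · exact lt_of_le_of_ne (min'_le _ _ (mem_of_mem_erase hx)) (ne_of_mem_erase hx).symm
    · rw [insert_erase (min'_mem _ _)]
  have haS : a ∉ S := fun h => lt_irrefl _ (ha a h)
  rw [card_insert_of_notMem haS] at hc
  rw [pf_insert_min _ _ _ ha, sum_powerset_insert haS]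
  have e1 : ∀ j ∈ S, (-1 : R) ^ (S.filter (fun t => t < j)).card * (Λ a j + Ξ a j) *
      pf (fun i j => Λ i j + Ξ i j) (S.erase j) =
      (∑ K ∈ (S.erase j).powerset, (-1 : R) ^ (S.filter (fun t => t < j)).card * Ξ a j *
        (if Even K.card then wt μ (S.erase j) K * pf Ξ (S.erase j \ K) else 0)) +
      (∑ K ∈ (S.erase j).powerset, (-1 : R) ^ (S.filter (fun t => t < j)).card *
        (- (μ a * μ j)) *
        (if Even K.card then wt μ (S.erase j) K * pf Ξ (S.erase j \ K) else 0)) := by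
    intro j hj
    rw [ih (S.erase j).card (by have := card_erase_lt_of_mem hj; omega) _ rfl,
      ← mul_sum, ← mul_sum, hΛ a j (ha j hj)]
    ring
  rw [sum_congr rfl e1, sum_add_distrib]
  congr 1
  · rw [sum_comm' (t' := S.powerset) (s' := fun K => S \ K)]
    · refine sum_congr rfl fun K hK => ?_
      rw [mem_powerset] at hK
      have haK : a ∉ K := fun h => haS (hK h)
      split_ifs with he
      · rw [insert_sdiff_of_notMem _ haK,
          pf_insert_min _ _ _ (fun x hx => ha x (mem_sdiff.1 hx).1), mul_sum]
        refine sum_congr rfl fun j hj => ?_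
        rw [mem_sdiff] at hj
        have hKj : K ⊆ S.erase j := fun x hx => mem_erase.2 ⟨fun h => hj.2 (h ▸ hx), hK hx⟩
        rw [wt_insert_min _ _ _ _ ha hK, he.neg_one_pow, wt_erase μ S K j hj.1 hKj]
        have hsd : S.erase j \ K = (S \ K).erase j := by
          ext x; simp; tauto
        have hs : (-1 : R) ^ (S.filter (fun t => t < j)).card =
            (-1) ^ (K.filter (fun t => j < t)).card *
              (-1) ^ ((S \ K).filter (fun t => t < j)).card := by
          rw [← pow_add]
          apply neg_one_pow_parity
          have h1 := card_split K j hj.2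
          have h2 : ((S \ K).filter (fun t => t < j)).card + (K.filter (fun t => t < j)).card
              = (S.filter (fun t => t < j)).card := by
            rw [← card_union_of_disjoint, ← filter_union, sdiff_union_of_subset hK]
            exact disjoint_filter_filter sdiff_disjoint
          rw [Nat.even_iff] at *
          omega
        rw [hs, hsd]
        ring
      · simp
    · intro j K
      simp only [mem_powerset, mem_sdiff, subset_erase]
      tauto
  · have e2 : ∀ K ∈ S.powerset, (if Even (insert a K).card then
        wt μ (insert a S) (insert a K) * pf Ξ (insert a S \ insert a K) else 0) =
        ∑ j ∈ K, (-1 : R) ^ (K.filter (fun t => t < j)).card *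
          (if Even (insert a K).card then
          wt μ (insert a S) (insert a K) * pf Ξ (insert a S \ insert a K) else 0) := by
      intro K hK
      rw [mem_powerset] at hK
      have haK : a ∉ K := fun h => haS (hK h)
      rw [← sum_mul, alt_sum, card_insert_of_notMem haK]
      by_cases he : Even K.card <;> simp [he, Nat.even_add_one]
    rw [sum_congr rfl e2, sum_sigma', sum_sigma']
    refine sum_bij' (fun p _ => ⟨insert p.1 p.2, p.1⟩) (fun p _ => ⟨p.2, p.1.erase p.2⟩)
      ?_ ?_ ?_ ?_ ?_
    · rintro ⟨j, K⟩ h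
      simp only [mem_sigma, mem_powerset, subset_erase] at h ⊢
      exact ⟨insert_subset h.1 h.2.1, mem_insert_self _ _⟩
    · rintro ⟨K, j⟩ h
      simp only [mem_sigma, mem_powerset] at h ⊢
      exact ⟨h.1 h.2, erase_subset_erase _ h.1⟩
    · rintro ⟨j, K⟩ h
      simp only [mem_sigma, mem_powerset, subset_erase] at h ⊢
      rw [erase_insert h.2.2]
    · rintro ⟨K, j⟩ h
      simp only [mem_sigma, mem_powerset] at h ⊢
      rw [insert_erase h.2]
    · rintro ⟨j, K⟩ h
      simp only [mem_sigma, mem_powerset] at h ⊢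
      obtain ⟨hj, hKj⟩ := h
      obtain ⟨hK, hjK⟩ := subset_erase.1 hKj
      have haK : a ∉ insert j K := fun h => haS (insert_subset hj hK h)
      rw [card_insert_of_notMem haK, card_insert_of_notMem hjK]
      have hpar : Even (K.card + 1 + 1) ↔ Even K.card := by
        simp [Nat.even_add_one]
      simp only [hpar]
      split_ifs with he
      · have hsd : insert a S \ insert a (insert j K) = S.erase j \ K := by
          ext x
          simp only [mem_sdiff, mem_insert, mem_erase]
          have : x = a → x ∉ S := fun h => h ▸ haS
          tauto
        have hw : wt μ (insert a S) (insert a (insert j K)) =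
            μ a * ((-1 : R) ^ ((S.filter (fun t => t < j)).card + 1) * μ j *
              wt μ S K) := by
          have h0 : wt μ (insert a S) (insert a (insert j K)) =
              μ a * wt μ (insert a S) (insert j K) := by
            unfold wt
            rw [prod_insert haK]
            congr 1
            rw [filter_false_of_mem]
            · simp
            · intro x hx
              rcases mem_insert.1 hx with h | h
              · omega
              · have := ha x h; omega
          have h1 : wt μ S (insert j K) =
              ((-1 : R) ^ (S.filter (fun t => t < j)).card * μ j) * wt μ S K := by
            unfold wt
            rw [prod_insert hjK]
          rw [h0, wt_insert_min _ _ _ _ ha (insert_subset hj hK), h1,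
            card_insert_of_notMem hjK, pow_succ, pow_succ, he.neg_one_pow]
          ring
        rw [hsd, hw, wt_erase μ S K j hj hKj, filter_insert, if_neg (lt_irrefl _)]
        have hs : (-1 : R) ^ (K.filter (fun t => t < j)).card *
            (-1) ^ (K.filter (fun t => j < t)).card = 1 := by
          rw [← pow_add, card_split K j hjK, he.neg_one_pow]
        rw [pow_succ]
        linear_combination ((-1 : R) ^ (S.filter (fun t => t < j)).card * μ a * μ j *
          wt μ (S.erase j) K * pf Ξ (S.erase j \ K)) * hs
      · simp

/-- Valiant's Pfaffian Sum Theorem: for `n` even, skew-symmetric `Ξ`, ring elements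
`λ₁,…,λₙ`, and `Λ̃` the skew-symmetric matrix with above-diagonal entries
`λ̃ᵢⱼ = (−1)^{i+j+1} λᵢ λⱼ` (for `i < j`),
`∑_{J ⊆ {1,…,n}, |Jᶜ| even} (∏_{i ∈ Jᶜ} λᵢ) · Pf(Ξ_J) = Pf(Λ̃ + Ξ)`. -/
theorem pfaffian_sum {R : Type*} [CommRing R] (n : ℕ) (hn : Even n)
    (Ξ : ℕ → ℕ → R) (hΞ : ∀ i j, Ξ j i = - Ξ i j)
    (lam : ℕ → R) (Λ : ℕ → ℕ → R)
    (hΛ : ∀ i j, i < j → Λ i j = (-1 : R) ^ (i + j + 1) * lam i * lam j)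
    (hΛskew : ∀ i j, Λ j i = - Λ i j) :
    ∑ J ∈ (Finset.Icc 1 n).powerset.filter
        (fun J => Even (Finset.Icc 1 n \ J).card),
        (∏ i ∈ Finset.Icc 1 n \ J, lam i) * pf Ξ J
      = pf (fun i j => Λ i j + Ξ i j) (Finset.Icc 1 n) := by
  have key := pf_key Ξ Λ (fun i => (-1 : R) ^ (i + 1) * lam i) (fun i j hij => by
    rw [hΛ i j hij]; ring) (Finset.Icc 1 n)
  rw [key, ← Finset.sum_filter]
  refine Finset.sum_bij' (fun J _ => Finset.Icc 1 n \ J) (fun J _ => Finset.Icc 1 n \ J)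
    ?_ ?_ ?_ ?_ ?_
  · intro J h
    simp only [Finset.mem_filter, Finset.mem_powerset] at h ⊢
    exact ⟨Finset.sdiff_subset, h.2⟩
  · intro J h
    simp only [Finset.mem_filter, Finset.mem_powerset] at h ⊢
    refine ⟨Finset.sdiff_subset, ?_⟩
    rw [Finset.sdiff_sdiff_eq_self h.1]
    exact h.2
  · intro J h
    simp only [Finset.mem_filter, Finset.mem_powerset] at h
    exact Finset.sdiff_sdiff_eq_self h.1
  · intro J h
    simp only [Finset.mem_filter, Finset.mem_powerset] at h
    exact Finset.sdiff_sdiff_eq_self h.1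
  · intro J h
    simp only [Finset.mem_filter, Finset.mem_powerset] at h
    rw [Finset.sdiff_sdiff_eq_self h.1]
    congr 1
    unfold wt
    refine Finset.prod_congr rfl fun k hk => ?_
    have hk' := Finset.mem_Icc.1 (Finset.mem_sdiff.1 hk).1
    have hf : (Finset.Icc 1 n).filter (fun t => t < k) = Finset.Ico 1 k := by
      ext x
      simp only [Finset.mem_filter, Finset.mem_Icc, Finset.mem_Ico]
      omega
    rw [hf, Nat.card_Ico, ← mul_assoc, ← pow_add, Even.neg_one_pow, one_mul]
    rw [Nat.even_iff]
    omega
end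

section
/- (All arity-three predicates are Pfaffian after free basis change.) Let T be any nonzero tensor in ℂ² ⊗ ℂ² ⊗ ℂ². Then there exist invertible matrices A, B, C ∈ GL₂(ℂ), a nonzero scalar α ∈ ℂ, and complex numbers a, b, c such that (A ⊗ B ⊗ C)T = α( |000⟩ + a|110⟩ + b|101⟩ + c|011⟩ ); that is, (A ⊗ B ⊗ C)T is a nonzero scalar multiple of the subPfaffian tensor sPf(Ξ) of the 3×3 skew-symmetric matrix Ξ with above-diagonal entries ξ₁₂ = a, ξ₁₃ = b, ξ₂₃ = c. -/
/-- The subPfaffian tensor of the 3×3 skew-symmetric matrix with above-diagonal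
entries `ξ₁₂ = a, ξ₁₃ = b, ξ₂₃ = c`, as a coefficient function:
`sPf(Ξ) = |000⟩ + a|110⟩ + b|101⟩ + c|011⟩`. -/
def spf3 (a b c : ℂ) : (Fin 3 → Fin 2) → ℂ := fun x =>
  if x = ![0, 0, 0] then 1
  else if x = ![1, 1, 0] then a
  else if x = ![1, 0, 1] then b
  else if x = ![0, 1, 1] then c
  else 0

/-- Determinant of a pair of vectors. -/
def dt (f g : Fin 2 → ℂ) : ℂ := f 0 * g 1 - f 1 * g 0

/-- Linear combination of two vectors. -/
def lc (p q : ℂ) (f g : Fin 2 → ℂ) : Fin 2 → ℂ := fun i => p * f i + q * g i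

/-- Trilinearity. -/
def IsTri (F : (Fin 2 → ℂ) → (Fin 2 → ℂ) → (Fin 2 → ℂ) → ℂ) : Prop :=
  (∀ p q f f' g h, F (lc p q f f') g h = p * F f g h + q * F f' g h) ∧
  (∀ p q f g g' h, F f (lc p q g g') h = p * F f g h + q * F f g' h) ∧
  (∀ p q f g h h', F f g (lc p q h h') = p * F f g h + q * F f g h')

/-- Normalised bases with the odd part of weight one vanishing. -/
def Pre (F : (Fin 2 → ℂ) → (Fin 2 → ℂ) → (Fin 2 → ℂ) → ℂ) (f0 f1 g0 g1 h0 h1 : Fin 2 → ℂ) : Prop :=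
  dt f0 f1 ≠ 0 ∧ dt g0 g1 ≠ 0 ∧ dt h0 h1 ≠ 0 ∧ F f0 g0 h0 ≠ 0 ∧
    F f1 g0 h0 = 0 ∧ F f0 g1 h0 = 0 ∧ F f0 g0 h1 = 0

/-- All odd coefficients vanish in suitable bases. -/
def Good (F : (Fin 2 → ℂ) → (Fin 2 → ℂ) → (Fin 2 → ℂ) → ℂ) : Prop :=
  ∃ f0 f1 g0 g1 h0 h1, Pre F f0 f1 g0 g1 h0 h1 ∧ F f1 g1 h1 = 0

lemma dt_lc (p q r s : ℂ) (f g : Fin 2 → ℂ) :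
    dt (lc p q f g) (lc r s f g) = (p * s - q * r) * dt f g := by
  simp only [dt, lc]; ring

lemma good_generic {F} (hF : IsTri F) {f0 f1 g0 g1 h0 h1 : Fin 2 → ℂ}
    (hp : Pre F f0 f1 g0 g1 h0 h1) (ha : F f1 g1 h0 ≠ 0) (hb : F f1 g0 h1 ≠ 0) : Good F := by
  obtain ⟨d1, d2, d3, hN, e1, e2, e3⟩ := hp
  obtain ⟨l1, l2, l3⟩ := hF
  obtain ⟨s, hs⟩ : ∃ s, s * (2 * F f1 g1 h0 * F f1 g0 h1) = F f1 g1 h1 * F f0 g0 h0 :=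
    ⟨F f1 g1 h1 * F f0 g0 h0 / (2 * F f1 g1 h0 * F f1 g0 h1), by field_simp⟩
  refine ⟨lc 1 s f0 f1, lc 0 1 f0 f1, lc 1 0 g0 g1, lc (-(s * F f1 g1 h0)) (F f0 g0 h0) g0 g1,
    lc 1 0 h0 h1, lc (-(s * F f1 g0 h1)) (F f0 g0 h0) h0 h1, ⟨?_, ?_, ?_, ?_, ?_, ?_, ?_⟩, ?_⟩
  · rw [dt_lc]; simpa using d1
  · rw [dt_lc]; simpa using ⟨hN, d2⟩
  · rw [dt_lc]; simpa using ⟨hN, d3⟩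
  all_goals simp only [l1, l2, l3, e1, e2, e3]
  · simpa using hN
  · ring
  · ring
  · ring
  · linear_combination (-F f0 g0 h0) * hs

lemma good_special {F} (hF : IsTri F) {f0 f1 g0 g1 h0 h1 : Fin 2 → ℂ}
    (hp : Pre F f0 f1 g0 g1 h0 h1) (ha : F f1 g1 h0 = 0) (hb : F f1 g0 h1 = 0) : Good F := by
  by_cases hd : F f1 g1 h1 = 0
  · exact ⟨_, _, _, _, _, _, hp, hd⟩
  obtain ⟨d1, d2, d3, hN, e1, e2, e3⟩ := hp
  obtain ⟨l1, l2, l3⟩ := hF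
  obtain ⟨k, hk⟩ : ∃ k, k * F f1 g1 h1 = - F f0 g1 h1 :=
    ⟨-F f0 g1 h1 / F f1 g1 h1, by field_simp⟩
  refine ⟨lc 1 (k + 1) f0 f1, lc (-1) (1 - k) f0 f1, lc 1 1 g0 g1, lc (-1) 1 g0 g1,
    lc (F f1 g1 h1) (F f0 g0 h0) h0 h1, lc (-F f1 g1 h1) (F f0 g0 h0) h0 h1,
    ⟨?_, ?_, ?_, ?_, ?_, ?_, ?_⟩, ?_⟩
  · rw [dt_lc]; refine mul_ne_zero ?_ d1; ring_nf; norm_num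
  · rw [dt_lc]; refine mul_ne_zero ?_ d2; norm_num
  · rw [dt_lc]; refine mul_ne_zero ?_ d3
    have : F f1 g1 h1 * F f0 g0 h0 - F f0 g0 h0 * -F f1 g1 h1 = 2 * (F f1 g1 h1 * F f0 g0 h0) := by
      ring
    rw [this]; simp [hd, hN]
  all_goals simp only [l1, l2, l3, e1, e2, e3, ha, hb]
  · have h2 : 2 * (F f1 g1 h1 * F f0 g0 h0) ≠ 0 := by simp [hd, hN]
    intro h; apply h2; linear_combination h - F f0 g0 h0 * hk
  · linear_combination (-F f0 g0 h0) * hk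
  · linear_combination (F f0 g0 h0) * hk
  · linear_combination (F f0 g0 h0) * hk
  · linear_combination (-F f0 g0 h0) * hk

lemma good_swap12 {F} (h : Good (fun f g h => F g f h)) : Good F := by
  obtain ⟨f0, f1, g0, g1, h0, h1, ⟨a1, a2, a3, a4, a5, a6, a7⟩, a8⟩ := h
  exact ⟨g0, g1, f0, f1, h0, h1, ⟨a2, a1, a3, a4, a6, a5, a7⟩, a8⟩

lemma good_swap13 {F} (h : Good (fun f g h => F h g f)) : Good F := by
  obtain ⟨f0, f1, g0, g1, h0, h1, ⟨a1, a2, a3, a4, a5, a6, a7⟩, a8⟩ := h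
  exact ⟨h0, h1, g0, g1, f0, f1, ⟨a3, a2, a1, a4, a7, a6, a5⟩, a8⟩

lemma good_of_pre {F} (hF : IsTri F) {f0 f1 g0 g1 h0 h1 : Fin 2 → ℂ}
    (hp : Pre F f0 f1 g0 g1 h0 h1) : Good F := by
  have hF' := hF
  have hp' := hp
  obtain ⟨l1, l2, l3⟩ := hF'
  obtain ⟨d1, d2, d3, hN, e1, e2, e3⟩ := hp'
  have t12 : IsTri (fun f g h => F g f h) :=
    ⟨fun p q f f' g h => l2 p q g f f' h, fun p q f g g' h => l1 p q g g' f h,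
      fun p q f g h h' => l3 p q g f h h'⟩
  have t13 : IsTri (fun f g h => F h g f) :=
    ⟨fun p q f f' g h => l3 p q h g f f', fun p q f g g' h => l2 p q h g g' f,
      fun p q f g h h' => l1 p q h h' g f⟩
  have p12 : Pre (fun f g h => F g f h) g0 g1 f0 f1 h0 h1 := ⟨d2, d1, d3, hN, e2, e1, e3⟩
  have p13 : Pre (fun f g h => F h g f) h0 h1 g0 g1 f0 f1 := ⟨d3, d2, d1, hN, e3, e2, e1⟩
  by_cases ha : F f1 g1 h0 = 0 <;> by_cases hb : F f1 g0 h1 = 0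
  · exact good_special hF hp ha hb
  · by_cases hc : F f0 g1 h1 = 0
    · exact good_swap12 (good_special t12 p12 ha hc)
    · exact good_swap13 (good_generic t13 p13 hc hb)
  · by_cases hc : F f0 g1 h1 = 0
    · exact good_swap13 (good_special t13 p13 hc hb)
    · exact good_swap12 (good_generic t12 p12 ha hc)
  · exact good_generic hF hp ha hb

/-- Standard basis vectors. -/
def ev (i : Fin 2) : Fin 2 → ℂ := fun j => if j = i then 1 else 0

lemma lc_ev (f : Fin 2 → ℂ) : f = lc (f 0) (f 1) (ev 0) (ev 1) := by
  funext i; fin_cases i <;> simp [lc, ev]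

/-- The kernel vector of a linear form. -/
lemma exists_ker (L : (Fin 2 → ℂ) → ℂ) (hL : ∀ p q f f', L (lc p q f f') = p * L f + q * L f')
    (f : Fin 2 → ℂ) (hf : L f ≠ 0) : ∃ f', dt f f' ≠ 0 ∧ L f' = 0 := by
  refine ⟨lc (-L (ev 1)) (L (ev 0)) (ev 0) (ev 1), ?_, ?_⟩
  · have h := hf
    rw [lc_ev f, hL] at h
    intro h0; apply h
    simp [dt, lc, ev] at h0
    linear_combination h0
  · rw [hL]; ring

lemma good_of_ne {F} (hF : IsTri F) {f g h : Fin 2 → ℂ} (hN : F f g h ≠ 0) : Good F := by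
  obtain ⟨f', df, ef⟩ := exists_ker (fun f => F f g h) (fun p q f f' => hF.1 p q f f' g h) f hN
  obtain ⟨g', dg, eg⟩ := exists_ker (fun g => F f g h) (fun p q g g' => hF.2.1 p q f g g' h) g hN
  obtain ⟨h', dh, eh⟩ := exists_ker (fun h => F f g h) (fun p q h h' => hF.2.2 p q f g h h') h hN
  exact good_of_pre hF ⟨df, dg, dh, hN, ef, eg, eh⟩

/-- The trilinear form of a tensor. -/
def tri (T : (Fin 3 → Fin 2) → ℂ) (f g h : Fin 2 → ℂ) : ℂ :=
  ∑ y : Fin 3 → Fin 2, (f (y 0) * g (y 1) * h (y 2)) * T y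

lemma tri_isTri (T : (Fin 3 → Fin 2) → ℂ) : IsTri (tri T) := by
  refine ⟨?_, ?_, ?_⟩ <;> intros <;>
    simp only [tri, lc, Finset.mul_sum, ← Finset.sum_add_distrib] <;>
    exact Finset.sum_congr rfl fun y _ => by ring

lemma tri_ev (T : (Fin 3 → Fin 2) → ℂ) (x : Fin 3 → Fin 2) :
    tri T (ev (x 0)) (ev (x 1)) (ev (x 2)) = T x := by
  rw [tri, Finset.sum_eq_single x]
  · simp [ev]
  · intro y _ hy
    have : ¬ (y 0 = x 0 ∧ y 1 = x 1 ∧ y 2 = x 2) := by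
      rintro ⟨h0, h1, h2⟩
      apply hy; funext i; fin_cases i <;> assumption
    simp only [ev]
    split_ifs <;> simp_all
  · simp

lemma exists_gl (f g : Fin 2 → ℂ) (h : dt f g ≠ 0) :
    ∃ A : GL (Fin 2) ℂ, (A : Matrix (Fin 2) (Fin 2) ℂ) = Matrix.of ![f, g] := by
  refine ⟨Matrix.GeneralLinearGroup.mkOfDetNeZero (Matrix.of ![f, g]) ?_, rfl⟩
  rw [Matrix.det_fin_two]; simpa [dt] using h

/-- Every nonzero tensor in `ℂ² ⊗ ℂ² ⊗ ℂ²` becomes, after a free (heterogeneous)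
basis change `A ⊗ B ⊗ C` with `A, B, C ∈ GL₂(ℂ)`, a nonzero scalar multiple of
the subPfaffian tensor `|000⟩ + a|110⟩ + b|101⟩ + c|011⟩` of a `3×3`
skew-symmetric matrix. -/
theorem arity_three_free_basis_pfaffian (T : (Fin 3 → Fin 2) → ℂ) (hT : T ≠ 0) :
    ∃ (A B C : GL (Fin 2) ℂ) (α : ℂ) (a b c : ℂ), α ≠ 0 ∧
      ∀ x : Fin 3 → Fin 2,
        (∑ y : Fin 3 → Fin 2,
            ((A : Matrix (Fin 2) (Fin 2) ℂ) (x 0) (y 0) *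
             (B : Matrix (Fin 2) (Fin 2) ℂ) (x 1) (y 1) *
             (C : Matrix (Fin 2) (Fin 2) ℂ) (x 2) (y 2)) * T y)
          = α * spf3 a b c x := by
  obtain ⟨x, hx⟩ : ∃ x, T x ≠ 0 := by
    by_contra hcon
    push Not at hcon
    exact hT (funext hcon)
  rw [← tri_ev T x] at hx
  obtain ⟨f0, f1, g0, g1, h0, h1, ⟨d1, d2, d3, hN, e1, e2, e3⟩, e4⟩ :=
    good_of_ne (tri_isTri T) hx
  obtain ⟨A, hA⟩ := exists_gl _ _ d1
  obtain ⟨B, hB⟩ := exists_gl _ _ d2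
  obtain ⟨C, hC⟩ := exists_gl _ _ d3
  refine ⟨A, B, C, tri T f0 g0 h0, tri T f1 g1 h0 / tri T f0 g0 h0,
    tri T f1 g0 h1 / tri T f0 g0 h0, tri T f0 g1 h1 / tri T f0 g0 h0, hN, ?_⟩
  intro x
  rw [hA, hB, hC]
  change tri T (![f0, f1] (x 0)) (![g0, g1] (x 1)) (![h0, h1] (x 2)) = _
  obtain ⟨i, j, k, rfl⟩ : ∃ i j k, x = ![i, j, k] :=
    ⟨x 0, x 1, x 2, by funext i; fin_cases i <;> rfl⟩
  fin_cases i <;> fin_cases j <;> fin_cases k <;>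
    simp [spf3, e1, e2, e3, e4, mul_div_cancel₀ _ hN]
  all_goals field_simp
end

section
/- (Valiant's two-input two-output matchgate condition is equivalent to being a subPfaffian tensor.) Let F be a field and let b₁₄, b₄₁, b₂₂, b₂₃, b₃₂, b₃₃, b₄₄ ∈ F, with b₁₁ = 1. Then the equal-determinant condition b₁₁b₄₄ − b₁₄b₄₁ = b₂₂b₃₃ − b₂₃b₃₂ (i.e. det B_even = det B_odd for the 2×2 blocks B_even = [[b₁₁,b₁₄],[b₄₁,b₄₄]] and B_odd = [[b₂₂,b₂₃],[b₃₂,b₃₃]]) holds if and only if the arity-four tensor G = |0000⟩ + b₁₄|1100⟩ + b₂₃|1010⟩ + b₃₃|1001⟩ + b₂₂|0110⟩ + b₃₂|0101⟩ + b₄₁|0011⟩ + b₄₄|1111⟩ equals sPf(Ξ) for some 4×4 skew-symmetric matrix Ξ over F, namely the matrix with above-diagonal entries ξ₁₂ = b₁₄, ξ₁₃ = b₂₃, ξ₁₄ = b₃₃, ξ₂₃ = b₂₂, ξ₂₄ = b₃₂, ξ₃₄ = b₄₁. -/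
/-- The set of ones of a bitstring `x : Fin n → Fin 2`, with positions labelled
`1,…,n`, so that the coefficient of `|x⟩` in `sPf(Ξ)` is `pf Ξ (supp x)`. -/
def supp {n : ℕ} (x : Fin n → Fin 2) : Finset ℕ :=
  (Finset.univ.filter (fun i => x i = 1)).image (fun i : Fin n => (i : ℕ) + 1)

theorem pf_insert' {R : Type*} [CommRing R] (M : ℕ → ℕ → R) (a : ℕ) (I : Finset ℕ)
    (h : ∀ i ∈ I, a < i) :
    pf M (insert a I) = ∑ j ∈ I, (-1 : R) ^ (((insert a I).filter (fun t => t < j)).card + 1)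
      * M a j * pf M (I.erase j) := by
  have hne : (insert a I).Nonempty := Finset.insert_nonempty a I
  have hm : (insert a I).min' hne = a := by
    apply le_antisymm
    · exact Finset.min'_le _ _ (Finset.mem_insert_self a I)
    · apply Finset.le_min'
      intro y hy
      rcases Finset.mem_insert.1 hy with rfl | hy
      · exact le_rfl
      · exact (h y hy).le
  have ha : a ∉ I := fun hh => lt_irrefl _ (h a hh)
  rw [pf, dif_pos hne]
  simp only [hm, Finset.erase_insert ha]

theorem pf_one' {R : Type*} [CommRing R] (M : ℕ → ℕ → R) (a : ℕ) : pf M {a} = 0 := by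
  have := pf_insert' M a ∅ (by simp)
  simpa using this

theorem pf_two' {R : Type*} [CommRing R] (M : ℕ → ℕ → R) (a b : ℕ) (h : a < b) :
    pf M {a, b} = M a b := by
  have := pf_insert' M a {b} (by simpa using h)
  rw [this]
  simp [Finset.filter_insert, Finset.filter_singleton, h, pf_empty']

theorem pf_three' {R : Type*} [CommRing R] (M : ℕ → ℕ → R) (a b c : ℕ) (h : a < b) (h' : b < c) :
    pf M {a, b, c} = 0 := by
  have := pf_insert' M a {b, c} (by simp; omega)
  rw [this]
  apply Finset.sum_eq_zero
  intro j hj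
  have e1 : ({b, c} : Finset ℕ).erase b = {c} := by ext t; simp; omega
  have e2 : ({b, c} : Finset ℕ).erase c = {b} := by ext t; simp; omega
  simp only [Finset.mem_insert, Finset.mem_singleton] at hj
  rcases hj with rfl | rfl
  · rw [e1, pf_one', mul_zero]
  · rw [e2, pf_one', mul_zero]

theorem pf_four' {R : Type*} [CommRing R] (M : ℕ → ℕ → R) :
    pf M {1, 2, 3, 4} = M 1 2 * M 3 4 - M 1 3 * M 2 4 + M 1 4 * M 2 3 := by
  rw [pf_insert' M 1 {2, 3, 4} (by decide)]
  rw [Finset.sum_insert (by decide), Finset.sum_insert (by decide), Finset.sum_singleton]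
  rw [show (({1, 2, 3, 4} : Finset ℕ).filter (fun t => t < 2)).card = 1 by decide,
    show (({1, 2, 3, 4} : Finset ℕ).filter (fun t => t < 3)).card = 2 by decide,
    show (({1, 2, 3, 4} : Finset ℕ).filter (fun t => t < 4)).card = 3 by decide,
    show ({2, 3, 4} : Finset ℕ).erase 2 = {3, 4} by decide,
    show ({2, 3, 4} : Finset ℕ).erase 3 = {2, 4} by decide,
    show ({2, 3, 4} : Finset ℕ).erase 4 = {2, 3} by decide,
    pf_two' M 3 4 (by decide), pf_two' M 2 4 (by decide), pf_two' M 2 3 (by decide)]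
  ring

theorem supp_four' (a b c d : Fin 2) : supp ![a, b, c, d] =
    (if a = 1 then {1} else ∅) ∪ (if b = 1 then {2} else ∅) ∪ (if c = 1 then {3} else ∅)
      ∪ (if d = 1 then {4} else ∅) := by
  revert a b c d; decide

theorem pf_supp_four' {R : Type*} [CommRing R] (M : ℕ → ℕ → R) (x : Fin 4 → Fin 2) :
    pf M (supp x) =
          (if x = ![0, 0, 0, 0] then 1
           else if x = ![1, 1, 0, 0] then M 1 2
           else if x = ![1, 0, 1, 0] then M 1 3
           else if x = ![1, 0, 0, 1] then M 1 4
           else if x = ![0, 1, 1, 0] then M 2 3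
           else if x = ![0, 1, 0, 1] then M 2 4
           else if x = ![0, 0, 1, 1] then M 3 4
           else if x = ![1, 1, 1, 1] then M 1 2 * M 3 4 - M 1 3 * M 2 4 + M 1 4 * M 2 3
           else 0) := by
  have hx : x = ![x 0, x 1, x 2, x 3] := by
    ext i; fin_cases i <;> rfl
  generalize x 0 = a at hx
  generalize x 1 = b at hx
  generalize x 2 = c at hx
  generalize x 3 = d at hx
  subst hx
  rw [supp_four']
  have h2 : ∀ a : Fin 2, a = 0 ∨ a = 1 := by decide
  rcases h2 a with rfl | rfl <;> rcases h2 b with rfl | rfl <;> rcases h2 c with rfl | rfl <;>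
    rcases h2 d with rfl | rfl <;>
    simp [pf_empty', pf_one', pf_two', pf_three', pf_four', Finset.insert_union]

/-- Valiant's two-input two-output matchgate condition is equivalent to being a
subPfaffian tensor: with `b₁₁ = 1`, the equal-determinant condition
`b₁₁b₄₄ − b₁₄b₄₁ = b₂₂b₃₃ − b₂₃b₃₂` holds iff the arity-four tensor
`G = |0000⟩ + b₁₄|1100⟩ + b₂₃|1010⟩ + b₃₃|1001⟩ + b₂₂|0110⟩ + b₃₂|0101⟩ +
b₄₁|0011⟩ + b₄₄|1111⟩` equals `sPf(Ξ)` for the `4×4` skew-symmetric `Ξ`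
with `ξ₁₂ = b₁₄, ξ₁₃ = b₂₃, ξ₁₄ = b₃₃, ξ₂₃ = b₂₂, ξ₂₄ = b₃₂, ξ₃₄ = b₄₁`. -/
theorem matchgate_iff_subPfaffian {F : Type*} [Field F]
    (b14 b41 b22 b23 b32 b33 b44 : F) :
    (1 * b44 - b14 * b41 = b22 * b33 - b23 * b32)
    ↔ ∃ Ξ : ℕ → ℕ → F, (∀ i j, Ξ j i = - Ξ i j) ∧
        Ξ 1 2 = b14 ∧ Ξ 1 3 = b23 ∧ Ξ 1 4 = b33 ∧
        Ξ 2 3 = b22 ∧ Ξ 2 4 = b32 ∧ Ξ 3 4 = b41 ∧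
        ∀ x : Fin 4 → Fin 2,
          (if x = ![0, 0, 0, 0] then 1
           else if x = ![1, 1, 0, 0] then b14
           else if x = ![1, 0, 1, 0] then b23
           else if x = ![1, 0, 0, 1] then b33
           else if x = ![0, 1, 1, 0] then b22
           else if x = ![0, 1, 0, 1] then b32
           else if x = ![0, 0, 1, 1] then b41
           else if x = ![1, 1, 1, 1] then b44
           else 0) = pf Ξ (supp x) := by
  simp only [pf_supp_four']
  constructor
  · intro h
    let g : ℕ → ℕ → F := fun i j =>
      if i = 1 ∧ j = 2 then b14 else if i = 1 ∧ j = 3 then b23 else if i = 1 ∧ j = 4 then b33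
      else if i = 2 ∧ j = 3 then b22 else if i = 2 ∧ j = 4 then b32
      else if i = 3 ∧ j = 4 then b41 else 0
    have h12 : g 1 2 - g 2 1 = b14 := by simp [g]
    have h13 : g 1 3 - g 3 1 = b23 := by simp [g]
    have h14 : g 1 4 - g 4 1 = b33 := by simp [g]
    have h23 : g 2 3 - g 3 2 = b22 := by simp [g]
    have h24 : g 2 4 - g 4 2 = b32 := by simp [g]
    have h34 : g 3 4 - g 4 3 = b41 := by simp [g]
    refine ⟨fun i j => g i j - g j i, fun i j => by ring, h12, h13, h14, h23, h24, h34, ?_⟩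
    intro x
    simp only [h12, h13, h14, h23, h24, h34]
    rw [show b44 = b14 * b41 - b23 * b32 + b33 * b22 by linear_combination h]
  · rintro ⟨Ξ, -, rfl, rfl, rfl, rfl, rfl, rfl, h⟩
    have := h ![1, 1, 1, 1]
    simp at this
    linear_combination this
end
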